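/- Let n ≥ 2 and let C be an N-point configuration on the unit sphere S^{n-1} ⊂ ℝ^n. Suppose (i) every N-point configuration on S^{n-1} whose distance distribution equals d_C is the image of C under an orthogonal transformation of ℝ^n, and (ii) d_C is extremal, i.e., d_C is an extreme point of the convex hull of the set of distance distributions of all N-point configurations on S^{n-1}. Then there exists an infinitely differentiable function V : (0,2] → ℝ such that for every N-point configuration C' on S^{n-1} one has E_V(C') ≥ E_V(C), with equality only if C' is the image of C under an orthogonal transformation of ℝ^n. -/

import Mathlib

open scoped Classical

/-- The `V`-potential energy of a finite configuration `C`: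
`E_V(C) = (1/2) ∑_{x,y ∈ C, x ≠ y} V(|x-y|)`. -/
noncomputable def energy {n : ℕ} (V : ℝ → ℝ) (C : Finset (EuclideanSpace ℝ (Fin n))) : ℝ :=
  (1 / 2) * ∑ x ∈ C, ∑ y ∈ C, if x = y then 0 else V (dist x y)

/-- The distance distribution of a finite configuration: `d_C(r)` is the number of
unordered pairs of distinct points of `C` at Euclidean distance `r`. -/
noncomputable def distDistrib {n : ℕ} (C : Finset (EuclideanSpace ℝ (Fin n))) : ℝ → ℝ :=
  fun r => ((C ×ˢ C).filter fun p => p.1 ≠ p.2 ∧ dist p.1 p.2 = r).card / 2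

/-- `C` lies on the unit sphere `S^{n-1}`. -/
def onSphere {n : ℕ} (C : Finset (EuclideanSpace ℝ (Fin n))) : Prop :=
  ∀ x ∈ C, ‖x‖ = 1

/-- `C'` is the image of `C` under an orthogonal transformation of `ℝ^n`. -/
def isOrthImage {n : ℕ} (C C' : Finset (EuclideanSpace ℝ (Fin n))) : Prop :=
  ∃ O : EuclideanSpace ℝ (Fin n) ≃ₗᵢ[ℝ] EuclideanSpace ℝ (Fin n), C' = C.image O

/-- The matrix of pairwise distances of an indexed family of points. -/
noncomputable def distMatrix {E : Type*} [PseudoMetricSpace E] {ι : Type*} (x : ι → E) :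
    ι → ι → ℝ :=
  fun i j => dist (x i) (x j)

/-- Half the sum of `V` over the off-diagonal entries of a matrix, for `V` with values in
a real vector space. -/
noncomputable def offDiagEnergy {F : Type*} [AddCommGroup F] [Module ℝ F] {ι : Type*} [Fintype ι]
    (V : ℝ → F) (ρ : ι → ι → ℝ) : F :=
  (1 / 2 : ℝ) • ∑ i, ∑ j, if i = j then 0 else V (ρ i j)

lemma energy_map {n : ℕ} {ι : Type*} [Fintype ι] (V : ℝ → ℝ)
    (x : ι ↪ EuclideanSpace ℝ (Fin n)) :
    energy V (Finset.univ.map x) = offDiagEnergy V (distMatrix x) := by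
  simp [energy, offDiagEnergy, distMatrix, Finset.sum_map]

lemma distDistrib_apply_eq_energy {n : ℕ} (C : Finset (EuclideanSpace ℝ (Fin n))) (r : ℝ) :
    distDistrib C r = energy (fun t => if t = r then 1 else 0) C := by
  rw [distDistrib, energy, Finset.card_filter, Finset.sum_product, one_div_mul_eq_div]
  push_cast
  congr 1
  refine Finset.sum_congr rfl fun x _ => Finset.sum_congr rfl fun y _ => ?_
  by_cases h : x = y <;> simp [h]

lemma distDistrib_map {n : ℕ} {ι : Type*} [Fintype ι]
    (x : ι ↪ EuclideanSpace ℝ (Fin n)) :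
    distDistrib (Finset.univ.map x) =
      offDiagEnergy (fun t => (Pi.single t 1 : ℝ → ℝ)) (distMatrix x) := by
  ext r
  rw [distDistrib_apply_eq_energy, energy_map]
  simp only [offDiagEnergy, Pi.smul_apply, Finset.sum_apply]
  congr 1
  refine Finset.sum_congr rfl fun i _ => Finset.sum_congr rfl fun j _ => ?_
  by_cases h : i = j <;> simp [h, Pi.single_apply, eq_comm]

lemma map_offDiagEnergy {F : Type*} [AddCommGroup F] [Module ℝ F] {ι : Type*} [Fintype ι]
    (f : F →ₗ[ℝ] ℝ) (V : ℝ → F) (ρ : ι → ι → ℝ) :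
    f (offDiagEnergy V ρ) = offDiagEnergy (fun t => f (V t)) ρ := by
  simp only [offDiagEnergy, map_smul, map_sum, apply_ite f, map_zero]

lemma offDiagEnergy_congr {ι : Type*} [Fintype ι] {V W : ℝ → ℝ} {ρ σ : ι → ι → ℝ}
    (h : ∀ i j, i ≠ j → V (ρ i j) = W (σ i j)) : offDiagEnergy V ρ = offDiagEnergy W σ := by
  unfold offDiagEnergy
  congr 1
  refine Finset.sum_congr rfl fun i _ => Finset.sum_congr rfl fun j _ => ?_
  split_ifs with hij
  · rfl
  · exact h i j hij

lemma offDiagEnergy_le {ι : Type*} [Fintype ι] {V W : ℝ → ℝ} {ρ σ : ι → ι → ℝ}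
    (h : ∀ i j, i ≠ j → V (ρ i j) ≤ W (σ i j)) :
    offDiagEnergy V ρ ≤ offDiagEnergy W σ ∧ (offDiagEnergy V ρ = offDiagEnergy W σ →
      ∀ i j, i ≠ j → V (ρ i j) = W (σ i j)) := by
  have hle : ∀ i j, (if i = j then 0 else V (ρ i j)) ≤ if i = j then 0 else W (σ i j) :=
    fun i j => by
      split_ifs with hij
      · exact le_rfl
      · exact h i j hij
  have hle' : ∀ i, (∑ j, if i = j then 0 else V (ρ i j)) ≤ ∑ j, if i = j then 0 else W (σ i j) :=
    fun i => Finset.sum_le_sum fun j _ => hle i j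
  refine ⟨smul_le_smul_of_nonneg_left (Finset.sum_le_sum fun i _ => hle' i) (by norm_num),
    fun heq i j hij => ?_⟩
  have hs := smul_right_injective ℝ (by norm_num : (1 / 2 : ℝ) ≠ 0) heq
  rw [Finset.sum_eq_sum_iff_of_le fun i _ => hle' i] at hs
  have hij' := (Finset.sum_eq_sum_iff_of_le fun j _ => hle i j).1
    (hs i (Finset.mem_univ i)) j (Finset.mem_univ j)
  rwa [if_neg hij, if_neg hij] at hij'

lemma le_two_mul_offDiagEnergy {ι : Type*} [Fintype ι] {V : ℝ → ℝ} {B : ℝ} (hB : 0 ≤ B)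
    (hV : ∀ t, -B ≤ V t) (ρ : ι → ι → ℝ) {i j : ι} (hij : i ≠ j) :
    V (ρ i j) - Fintype.card ι * (Fintype.card ι * B) ≤ 2 * offDiagEnergy V ρ := by
  have hsum : ∑ a, ∑ b, ((if a = i ∧ b = j then V (ρ i j) + B else 0) - B) ≤
      ∑ a, ∑ b, if a = b then 0 else V (ρ a b) := by
    refine Finset.sum_le_sum fun a _ => Finset.sum_le_sum fun b _ => ?_
    by_cases h : a = i ∧ b = j
    · obtain ⟨rfl, rfl⟩ := h
      simp [hij]
    · have := hV (ρ a b)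
      rw [if_neg h]
      split_ifs <;> linarith
  have hval : ∑ a : ι, ∑ b : ι, ((if a = i ∧ b = j then V (ρ i j) + B else 0) - B) =
      V (ρ i j) + B - Fintype.card ι * (Fintype.card ι * B) := by
    simp [Finset.sum_sub_distrib, ite_and]
  rw [hval] at hsum
  rw [offDiagEnergy, smul_eq_mul]
  linarith

lemma exists_embedding_map_eq {α : Type*} {N : ℕ} {C : Finset α} (hC : C.card = N) :
    ∃ x : Fin N ↪ α, Finset.univ.map x = C := by
  refine ⟨(C.equivFinOfCardEq hC).symm.toEmbedding.trans (Function.Embedding.subtype _), ?_⟩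
  ext a
  simp only [Finset.mem_map, Finset.mem_univ, true_and]
  exact ⟨by rintro ⟨i, rfl⟩; exact ((C.equivFinOfCardEq hC).symm i).2,
    fun h => ⟨C.equivFinOfCardEq hC ⟨a, h⟩, by simp⟩⟩

/-- A smooth potential with prescribed strict local minima of prescribed depths at finitely
many points, constant away from a neighbourhood of these points. -/
lemma exists_contDiff_wells (R : Finset ℝ) (l : ℝ → ℝ) {M ε : ℝ} (hε : 0 < ε)
    (hM : ∀ r ∈ R, l r < M) :
    ∃ V : ℝ → ℝ, ContDiff ℝ (⊤ : ℕ∞) V ∧ (∀ r ∈ R, V r = l r) ∧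
      ∀ t, V t = M ∨ ∃ r ∈ R, |t - r| < ε ∧ l r ≤ V t ∧ (V t = l r → t = r) := by
  obtain ⟨δ, hδ0, hδε, hδ⟩ : ∃ δ > 0, δ < ε ∧
      ∀ p ∈ R.offDiag, 2 * δ < |p.1 - p.2| := by
    have h1 : ∀ᶠ δ : ℝ in nhdsWithin 0 (Set.Ioi 0),
        ∀ p ∈ R.offDiag, 2 * δ < |p.1 - p.2| := by
      rw [Filter.eventually_all_finset]
      intro p hp
      have hpos : 0 < |p.1 - p.2| := abs_pos.2 (sub_ne_zero.2 (Finset.mem_offDiag.1 hp).2.2)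
      filter_upwards [Ioo_mem_nhdsGT (half_pos hpos)] with δ hδ
      linarith [hδ.2]
    obtain ⟨δ, h, h'⟩ := (h1.and (Ioo_mem_nhdsGT hε)).exists
    exact ⟨δ, h'.1, h'.2, h⟩
  let b : ℝ → ℝ → ℝ := fun r t => Real.smoothTransition (1 - ((t - r) / δ) ^ 2)
  have b_off : ∀ r t, δ ≤ |t - r| → b r t = 0 := fun r t h => by
    refine Real.smoothTransition.zero_of_nonpos ?_
    have : 1 ≤ |(t - r) / δ| := by rwa [abs_div, abs_of_pos hδ0, one_le_div hδ0]
    have := one_le_pow₀ this (n := 2)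
    rw [sq_abs] at this
    linarith
  have b_self : ∀ r, b r r = 1 := fun r => by simp [b]
  have b_lt : ∀ r t, t ≠ r → b r t < 1 := fun r t h => by
    refine Real.smoothTransition.lt_one_of_lt_one ?_
    have : 0 < ((t - r) / δ) ^ 2 := by
      have : t - r ≠ 0 := sub_ne_zero.2 h
      positivity
    linarith
  let V : ℝ → ℝ := fun t => M - ∑ r ∈ R, (M - l r) * b r t
  have V_near : ∀ r ∈ R, ∀ t, |t - r| < δ → V t = M - (M - l r) * b r t := by
    intro r hr t ht
    simp only [V]
    rw [Finset.sum_eq_single_of_mem r hr]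
    intro s hs hsr
    rw [b_off s t, mul_zero]
    have h1 := hδ (r, s) (Finset.mem_offDiag.2 ⟨hr, hs, hsr.symm⟩)
    have h2 := abs_sub_le r t s
    rw [abs_sub_comm r t] at h2
    simp only at h1
    linarith
  refine ⟨V, ?_, ?_, ?_⟩
  · refine contDiff_const.sub (ContDiff.sum fun r _ => contDiff_const.mul ?_)
    refine Real.smoothTransition.contDiff.comp ?_
    fun_prop
  · intro r hr
    rw [V_near r hr r (by simpa using hδ0), b_self]
    ring
  · intro t
    by_cases h : ∃ r ∈ R, |t - r| < δ
    · obtain ⟨r, hr, ht⟩ := h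
      refine Or.inr ⟨r, hr, ht.trans hδε, ?_⟩
      rw [V_near r hr t ht]
      have hMr := hM r hr
      by_cases htr : t = r
      · subst htr
        simp [b_self]
      · have := mul_lt_mul_of_pos_left (b_lt r t htr) (sub_pos.2 hMr)
        exact ⟨by linarith, fun h => by linarith⟩
    · push Not at h
      left
      simp only [V]
      rw [Finset.sum_eq_zero fun r hr => by rw [b_off r t (h r hr), mul_zero], sub_zero]

/-- A matrix with entries in a fixed finite set that is sufficiently close to the distance
matrix of a family of points of a compact set is itself such a distance matrix. -/
lemma exists_pos_forall_mem_distMatrix_image {E : Type*} [PseudoMetricSpace E] {ι : Type*}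
    [Fintype ι] {K : Set E} (hK : IsCompact K) {R : Set ℝ} (hR : R.Finite) :
    ∃ ε > 0, ∀ x : ι → E, (∀ i, x i ∈ K) → ∀ ρ : ι → ι → ℝ, (∀ i j, ρ i j ∈ R) →
      (∀ i j, |dist (x i) (x j) - ρ i j| < ε) →
      ∃ y : ι → E, (∀ i, y i ∈ K) ∧ distMatrix y = ρ := by
  have hcont : Continuous (distMatrix : (ι → E) → ι → ι → ℝ) := by
    unfold distMatrix
    fun_prop
  have hΦ : IsClosed (distMatrix '' Set.univ.pi fun _ : ι => K) :=
    ((isCompact_univ_pi fun _ => hK).image hcont).isClosed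
  have hP : (Set.univ.pi fun _ : ι => Set.univ.pi fun _ : ι => R).Finite :=
    Set.Finite.pi fun _ => Set.Finite.pi fun _ => hR
  obtain ⟨ε, hε, hsub⟩ := (hP.subset Set.sdiff_subset).isCompact.exists_thickening_subset_open
    hΦ.isOpen_compl (fun ρ hρ => (hρ.2 : ρ ∉ _))
  refine ⟨ε, hε, fun x hx ρ hρ hd => ?_⟩
  by_contra hcon
  have hmem : distMatrix x ∈ (distMatrix '' Set.univ.pi fun _ : ι => K)ᶜ := by
    refine hsub (Metric.mem_thickening_iff.2 ⟨ρ, ⟨fun i _ j _ => hρ i j, ?_⟩, ?_⟩)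
    · rintro ⟨y, hy, rfl⟩
      exact hcon ⟨y, fun i => hy i trivial, rfl⟩
    · rw [dist_pi_lt_iff hε]
      intro i
      rw [dist_pi_lt_iff hε]
      exact fun j => hd i j
  exact hmem ⟨x, fun i _ => hx i, rfl⟩

/-- An extreme point of the convex hull of `D` is strictly separated, by a continuous linear
functional, from the other points of any finite subset of `D`. -/
lemma exists_forall_lt_of_mem_extremePoints_convexHull {F : Type*} [AddCommGroup F] [Module ℝ F]
    [TopologicalSpace F] [IsTopologicalAddGroup F] [ContinuousSMul ℝ F] [LocallyConvexSpace ℝ F]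
    [T2Space F] {D S : Set F} {d : F} (hd : d ∈ (convexHull ℝ D).extremePoints ℝ)
    (hS : S.Finite) (hSD : S ⊆ D) :
    ∃ f : F →L[ℝ] ℝ, ∀ d' ∈ S, d' ≠ d → f d < f d' := by
  have hnot : d ∉ convexHull ℝ (S \ {d}) := fun h =>
    (((convex_convexHull ℝ D).mem_extremePoints_iff_mem_sdiff_convexHull_sdiff).1 hd).2
      (convexHull_mono (Set.sdiff_subset_sdiff_left (hSD.trans (subset_convexHull ℝ D))) h)
  obtain ⟨f, u, h1, h2⟩ := geometric_hahn_banach_point_closed (convex_convexHull ℝ (S \ {d}))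
    ((hS.subset Set.sdiff_subset).isClosed_convexHull ℝ) hnot
  exact ⟨f, fun d' h h' => h1.trans (h2 d' (subset_convexHull ℝ _ ⟨h, h'⟩))⟩

/-- Theorem (potential wells): if `C` is (up to orthogonal transformations) the unique
`N`-point configuration on `S^{n-1}` with its distance distribution, and that distance
distribution is an extreme point of the convex hull of all distance distributions of
`N`-point configurations, then there is a smooth potential `V : (0,2] → ℝ` under which
`C` is the unique ground state (up to orthogonal transformations). -/
theorem potential_wells_exist (n N : ℕ) (hn : 2 ≤ n)
    (C : Finset (EuclideanSpace ℝ (Fin n))) (hcard : C.card = N) (hC : onSphere C)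
    (h_unique : ∀ C' : Finset (EuclideanSpace ℝ (Fin n)), C'.card = N → onSphere C' →
      distDistrib C' = distDistrib C → isOrthImage C C')
    (h_extremal : distDistrib C ∈
      Set.extremePoints ℝ (convexHull ℝ
        {d : ℝ → ℝ | ∃ C' : Finset (EuclideanSpace ℝ (Fin n)),
          C'.card = N ∧ onSphere C' ∧ distDistrib C' = d})) :
    ∃ V : ℝ → ℝ, ContDiffOn ℝ (⊤ : ℕ∞) V (Set.Ioc 0 2) ∧
      ∀ C' : Finset (EuclideanSpace ℝ (Fin n)), C'.card = N → onSphere C' →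
        energy V C ≤ energy V C' ∧ (energy V C' = energy V C → isOrthImage C C') := by
  obtain ⟨x₀, rfl⟩ := exists_embedding_map_eq hcard
  have sphere_iff : ∀ x : Fin N ↪ EuclideanSpace ℝ (Fin n),
      onSphere (Finset.univ.map x) ↔ ∀ i, x i ∈ Metric.sphere 0 1 := fun x => by
    simp [onSphere]
  let R : Finset ℝ := (Finset.univ.filter fun p : Fin N × Fin N => p.1 ≠ p.2).image
    fun p => distMatrix x₀ p.1 p.2
  have mem_R : ∀ i j, i ≠ j → distMatrix x₀ i j ∈ R := fun i j h =>
    Finset.mem_image.2 ⟨(i, j), by simpa using h, rfl⟩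
  have R_ne : ∀ r ∈ R, r ≠ 0 := by
    intro r hr
    obtain ⟨p, hp, rfl⟩ := Finset.mem_image.1 hr
    exact dist_ne_zero.2 (x₀.injective.ne (by simpa using hp))
  have hR0 : (insert 0 (R : Set ℝ)).Finite := R.finite_toSet.insert 0
  let T : Set (Fin N ↪ EuclideanSpace ℝ (Fin n)) := {x |
    (∀ i, x i ∈ Metric.sphere 0 1) ∧ ∀ i j, i ≠ j → distMatrix x i j ∈ R}
  have hSfin : ((fun x => distDistrib (Finset.univ.map x)) '' T).Finite := by
    refine ((Set.Finite.pi' fun _ : Fin N => Set.Finite.pi' fun _ : Fin N => hR0).image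
      (offDiagEnergy fun t => (Pi.single t 1 : ℝ → ℝ))).subset ?_
    rintro _ ⟨x, hx, rfl⟩
    refine ⟨distMatrix x, fun i j => ?_, (distDistrib_map x).symm⟩
    by_cases hij : i = j
    · simp [hij, distMatrix]
    · exact Set.mem_insert_of_mem _ (hx.2 i j hij)
  obtain ⟨f, hf⟩ := exists_forall_lt_of_mem_extremePoints_convexHull h_extremal hSfin (by
    rintro _ ⟨x, hx, rfl⟩
    exact ⟨_, by simp, (sphere_iff x).2 hx.1, rfl⟩)
  let l : ℝ → ℝ := fun t => f (Pi.single t 1)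
  have f_eq : ∀ x : Fin N ↪ EuclideanSpace ℝ (Fin n),
      f (distDistrib (Finset.univ.map x)) = offDiagEnergy l (distMatrix x) := fun x => by
    rw [distDistrib_map]
    exact map_offDiagEnergy (f : (ℝ → ℝ) →ₗ[ℝ] ℝ) _ _
  obtain ⟨ε, hε, hcpt⟩ := exists_pos_forall_mem_distMatrix_image (ι := Fin N)
    (isCompact_sphere (0 : EuclideanSpace ℝ (Fin n)) 1) hR0
  obtain ⟨B, hB0, hB⟩ : ∃ B : ℝ, 0 ≤ B ∧ ∀ r ∈ R, |l r| ≤ B :=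
    ⟨∑ r ∈ R, |l r|, Finset.sum_nonneg fun _ _ => abs_nonneg _, fun r hr =>
      Finset.single_le_sum (f := fun r => |l r|) (fun _ _ => abs_nonneg _) hr⟩
  set e₀ : ℝ := offDiagEnergy l (distMatrix x₀) with he₀
  let M : ℝ := B + N * (N * B) + 2 * |e₀| + 1
  have hNB : 0 ≤ N * (N * B) := by positivity
  have hMB : B < M := by
    have := abs_nonneg e₀
    simp only [M]; linarith
  obtain ⟨V, hV, hVR, hVM⟩ := exists_contDiff_wells R l (M := M) hε
    fun r hr => (le_abs_self _).trans_lt ((hB r hr).trans_lt hMB)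
  have hVB : ∀ t, -B ≤ V t := fun t => by
    rcases hVM t with h | ⟨r, hr, -, h, -⟩
    · linarith
    · linarith [neg_abs_le (l r), hB r hr]
  have hE₀ : energy V (Finset.univ.map x₀) = e₀ := by
    rw [energy_map]
    exact offDiagEnergy_congr fun i j h => hVR _ (mem_R i j h)
  refine ⟨V, hV.contDiffOn, fun C' hcard' hC' => ?_⟩
  obtain ⟨x, rfl⟩ := exists_embedding_map_eq hcard'
  have hxs := (sphere_iff x).1 hC'
  by_cases hfar : ∃ i j, i ≠ j ∧ V (distMatrix x i j) = M
  · suffices h : e₀ < energy V (Finset.univ.map x) by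
      rw [hE₀]
      exact ⟨h.le, fun h' => absurd h' h.ne'⟩
    obtain ⟨i, j, hij, hM⟩ := hfar
    have h := le_two_mul_offDiagEnergy hB0 hVB (distMatrix x) hij
    rw [hM, Fintype.card_fin] at h
    rw [energy_map]
    have := le_abs_self e₀
    simp only [M] at h
    linarith
  · have hnear : ∀ i j, ∃ r, (i = j → r = 0) ∧ (i ≠ j → r ∈ R ∧ |distMatrix x i j - r| < ε ∧
        l r ≤ V (distMatrix x i j) ∧ (V (distMatrix x i j) = l r → distMatrix x i j = r)) := by
      intro i j
      by_cases hij : i = j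
      · exact ⟨0, fun _ => rfl, fun h => absurd hij h⟩
      · rcases hVM (distMatrix x i j) with h | ⟨r, hr, h⟩
        · exact absurd ⟨i, j, hij, h⟩ hfar
        · exact ⟨r, fun h => absurd h hij, fun _ => ⟨hr, h⟩⟩
    choose ρ hρ0 hρ using hnear
    obtain ⟨y, hys, rfl⟩ := hcpt x hxs ρ (fun i j => by
      by_cases hij : i = j
      · exact Or.inl (hρ0 i j hij)
      · exact Or.inr (hρ i j hij).1) (fun i j => by
      by_cases hij : i = j
      · rw [hρ0 i j hij, hij, dist_self]
        simpa using hε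
      · exact (hρ i j hij).2.1)
    have hy : Function.Injective y := fun i j h => by
      by_contra hij
      exact R_ne _ (hρ i j hij).1 (by simp [distMatrix, h])
    let y' : Fin N ↪ EuclideanSpace ℝ (Fin n) := ⟨y, hy⟩
    obtain ⟨hxy, hxy_eq⟩ := offDiagEnergy_le fun i j hij => (hρ i j hij).2.2.1
    have hyT : y' ∈ T := ⟨hys, fun i j hij => (hρ i j hij).1⟩
    have hlt : distDistrib (Finset.univ.map y') ≠ distDistrib (Finset.univ.map x₀) →
        e₀ < offDiagEnergy l (distMatrix y) := fun h => by
      have := hf _ ⟨y', hyT, rfl⟩ h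
      rwa [f_eq x₀, f_eq y'] at this
    have hge : e₀ ≤ offDiagEnergy l (distMatrix y) := by
      by_cases h : distDistrib (Finset.univ.map y') = distDistrib (Finset.univ.map x₀)
      · rw [he₀, ← f_eq x₀, ← h]
        exact (f_eq y').le
      · exact (hlt h).le
    rw [hE₀, energy_map]
    refine ⟨hge.trans hxy, fun heq => h_unique _ hcard' hC' ?_⟩
    have hyd : distDistrib (Finset.univ.map y') = distDistrib (Finset.univ.map x₀) := by
      by_contra h
      linarith [hlt h]
    have hVl : offDiagEnergy l (distMatrix y) = offDiagEnergy V (distMatrix x) :=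
      le_antisymm hxy (heq.trans_le hge)
    have hmat : distMatrix x = distMatrix y := by
      ext i j
      by_cases hij : i = j
      · simp [distMatrix, hij]
      · exact (hρ i j hij).2.2.2 (hxy_eq hVl i j hij).symm
    rw [distDistrib_map, hmat, ← hyd]
    exact (distDistrib_map y').symm
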